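/- arXiv:2503.00339 — 4 statements merged into one kernel-verified Lean document; each statement's English description precedes it below -/
import Mathlib

section
/- Let p : ℝ^D → ℝ be a probability density with respect to Lebesgue measure on ℝ^D satisfying ∫ ‖x‖ p(x) dx < ∞, and let σ > 0. Let q(y) = ∫ p(x) · (2πσ²)^{-D/2} · exp(-‖y - x‖²/(2σ²)) dx be the Gaussian-smoothed density. Then for every y ∈ ℝ^D, y + σ² · ∇(log q)(y) = ( ∫ x · p(x) · exp(-‖y - x‖²/(2σ²)) dx ) / ( ∫ p(x) · exp(-‖y - x‖²/(2σ²)) dx ); that is, Tweedie's correction of y by σ² times the score of the smoothed density equals the posterior mean of x under the posterior density x ↦ p(x)·(2πσ²)^{-D/2}·exp(-‖y-x‖²/(2σ²))/q(y). -/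
open MeasureTheory ProbabilityTheory Real

section GaussianWeight

theorem exp_neg_norm_sub_sq_le_one {E : Type*} [SeminormedAddCommGroup E] (σ : ℝ) (v x : E) :
    Real.exp (-‖v - x‖ ^ 2 / (2 * σ ^ 2)) ≤ 1 := by
  rw [Real.exp_le_one_iff, neg_div, neg_nonpos]
  positivity

theorem hasGradientAt_mul_exp_neg_norm_sub_sq {E : Type*} [NormedAddCommGroup E]
    [InnerProductSpace ℝ E] [CompleteSpace E] (c : ℝ) {σ : ℝ} (hσ : σ ≠ 0) (x v : E) :
    HasGradientAt (fun v => c * Real.exp (-‖v - x‖ ^ 2 / (2 * σ ^ 2)))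
      ((σ ^ 2)⁻¹ • (c * Real.exp (-‖v - x‖ ^ 2 / (2 * σ ^ 2))) • (x - v)) v := by
  have h := ((((hasFDerivAt_id v).sub_const x).norm_sq.neg.mul_const
    (2 * σ ^ 2)⁻¹).exp).const_mul c
  rw [hasGradientAt_iff_hasFDerivAt]
  simp only [id, ← div_eq_mul_inv] at h
  refine h.congr_fderiv ?_
  ext w
  simp
  field_simp
  ring

variable {E : Type*} [NormedAddCommGroup E] [MeasurableSpace E] [BorelSpace E]
  [SecondCountableTopology E] {μ : Measure E}

theorem integrable_mul_exp_neg_norm_sub_sq {p : E → ℝ} (hp : Integrable p μ) (σ : ℝ) (v : E) :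
    Integrable (fun x => p x * Real.exp (-‖v - x‖ ^ 2 / (2 * σ ^ 2))) μ := by
  refine hp.mul_bdd (c := 1) (by fun_prop) (.of_forall fun x => ?_)
  rw [Real.norm_eq_abs, Real.abs_exp]
  exact exp_neg_norm_sub_sq_le_one σ v x

theorem integral_mul_exp_neg_norm_sub_sq_pos {p : E → ℝ} (hp_nonneg : ∀ x, 0 ≤ p x)
    (hp_pos : 0 < ∫ x, p x ∂μ) (σ : ℝ) (y : E) :
    0 < ∫ x, p x * Real.exp (-‖y - x‖ ^ 2 / (2 * σ ^ 2)) ∂μ := by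
  have hp : Integrable p μ := .of_integral_ne_zero hp_pos.ne'
  rw [integral_pos_iff_support_of_nonneg hp_nonneg hp] at hp_pos
  rw [integral_pos_iff_support_of_nonneg (fun x => mul_nonneg (hp_nonneg x) (Real.exp_nonneg _))
    (integrable_mul_exp_neg_norm_sub_sq hp σ y)]
  convert hp_pos using 2
  ext x
  simp [Real.exp_ne_zero]

theorem integrable_mul_exp_neg_norm_sub_sq_smul [NormedSpace ℝ E] {p : E → ℝ}
    (hp : Integrable p μ) (hp_mom : Integrable (fun x => ‖x‖ * p x) μ) (σ : ℝ) (v : E) :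
    Integrable (fun x => (p x * Real.exp (-‖v - x‖ ^ 2 / (2 * σ ^ 2))) • x) μ := by
  refine hp_mom.mono
    ((integrable_mul_exp_neg_norm_sub_sq hp σ v).aestronglyMeasurable.smul
      aestronglyMeasurable_id) (.of_forall fun x => ?_)
  rw [norm_smul, norm_mul, norm_mul, norm_norm, Real.norm_eq_abs (Real.exp _), Real.abs_exp,
    mul_comm ‖x‖]
  gcongr
  exact mul_le_of_le_one_right (norm_nonneg _) (exp_neg_norm_sub_sq_le_one σ v x)

theorem hasGradientAt_integral_mul_exp_neg_norm_sub_sq [InnerProductSpace ℝ E]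
    [CompleteSpace E] {p : E → ℝ} (hp : Integrable p μ)
    (hp_mom : Integrable (fun x => ‖x‖ * p x) μ) {σ : ℝ} (hσ : σ ≠ 0) (y : E) :
    HasGradientAt (fun v => ∫ x, p x * Real.exp (-‖v - x‖ ^ 2 / (2 * σ ^ 2)) ∂μ)
      (∫ x, (σ ^ 2)⁻¹ • (p x * Real.exp (-‖y - x‖ ^ 2 / (2 * σ ^ 2))) • (x - y) ∂μ) y := by
  have hint : Integrable
      (fun x => (σ ^ 2)⁻¹ • (p x * Real.exp (-‖y - x‖ ^ 2 / (2 * σ ^ 2))) • (x - y)) μ := by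
    simp only [smul_sub]
    exact ((integrable_mul_exp_neg_norm_sub_sq_smul hp hp_mom σ y).smul _).sub
      (((integrable_mul_exp_neg_norm_sub_sq hp σ y).smul_const y).smul _)
  have hmeas := (InnerProductSpace.toDual ℝ E).continuous.comp_aestronglyMeasurable
    hint.aestronglyMeasurable
  have hbound : Integrable (fun x => (σ ^ 2)⁻¹ * (‖‖x‖ * p x‖ + (‖y‖ + 1) * ‖p x‖)) μ :=
    (hp_mom.norm.add (hp.norm.const_mul _)).const_mul _
  have hle : ∀ x, ∀ v ∈ Metric.ball y 1, ‖InnerProductSpace.toDual ℝ E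
      ((σ ^ 2)⁻¹ • (p x * Real.exp (-‖v - x‖ ^ 2 / (2 * σ ^ 2))) • (x - v))‖ ≤
      (σ ^ 2)⁻¹ * (‖‖x‖ * p x‖ + (‖y‖ + 1) * ‖p x‖) := by
    intro x v hv
    have hexp := exp_neg_norm_sub_sq_le_one σ v x
    have hv' : ‖v‖ ≤ ‖y‖ + 1 := by
      have h1 := norm_le_norm_add_norm_sub' v y
      rw [mem_ball_iff_norm] at hv
      linarith
    have hxv : ‖x - v‖ ≤ ‖x‖ + (‖y‖ + 1) := (norm_sub_le x v).trans (by gcongr)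
    rw [LinearIsometryEquiv.norm_map, norm_smul, norm_smul, norm_mul, norm_mul, norm_norm,
      Real.norm_eq_abs (Real.exp _), Real.abs_exp, Real.norm_of_nonneg (by positivity)]
    gcongr
    calc ‖p x‖ * Real.exp (-‖v - x‖ ^ 2 / (2 * σ ^ 2)) * ‖x - v‖
        ≤ ‖p x‖ * 1 * (‖x‖ + (‖y‖ + 1)) := by gcongr
      _ = ‖x‖ * ‖p x‖ + (‖y‖ + 1) * ‖p x‖ := by ring
  have h := hasFDerivAt_integral_of_dominated_of_fderiv_le
    (F := fun v x => p x * Real.exp (-‖v - x‖ ^ 2 / (2 * σ ^ 2)))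
    (F' := fun v x => InnerProductSpace.toDual ℝ E
      ((σ ^ 2)⁻¹ • (p x * Real.exp (-‖v - x‖ ^ 2 / (2 * σ ^ 2))) • (x - v)))
    (Metric.ball_mem_nhds y one_pos)
    (.of_forall fun v => (integrable_mul_exp_neg_norm_sub_sq hp σ v).aestronglyMeasurable)
    (integrable_mul_exp_neg_norm_sub_sq hp σ y) hmeas (.of_forall hle) hbound
    (.of_forall fun x v _ => (hasGradientAt_mul_exp_neg_norm_sub_sq (p x) hσ x v).hasFDerivAt)
  rw [hasGradientAt_iff_hasFDerivAt]
  refine h.congr_fderiv ?_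
  have hdual : Integrable (fun x => InnerProductSpace.toDual ℝ E
      ((σ ^ 2)⁻¹ • (p x * Real.exp (-‖y - x‖ ^ 2 / (2 * σ ^ 2))) • (x - y))) μ :=
    hbound.mono' hmeas (.of_forall fun x => hle x y (Metric.mem_ball_self one_pos))
  ext w
  rw [ContinuousLinearMap.integral_apply hdual]
  simp only [InnerProductSpace.toDual_apply_apply]
  simp_rw [real_inner_comm w]
  exact integral_inner hint w

end GaussianWeight

/-- Tweedie's correction of `y` by `σ²` times the score of the Gaussian-smoothed density `q`
equals the posterior mean of `x` under the posterior density
`x ↦ p(x) * (2πσ²)^(-D/2) * exp (-‖y - x‖²/(2σ²)) / q(y)`. -/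
theorem tweedie_correction_eq_posterior_mean
    {D : ℕ}
    (p : EuclideanSpace ℝ (Fin D) → ℝ)
    (hp_meas : Measurable p) (hp_nonneg : ∀ x, 0 ≤ p x)
    (hp_int : ∫ x, p x = 1)
    (hp_mom : Integrable (fun x => ‖x‖ * p x))
    (σ : ℝ) (hσ : 0 < σ)
    (q : EuclideanSpace ℝ (Fin D) → ℝ)
    (hq : ∀ y, q y = ∫ x, p x * ((2 * π * σ ^ 2) ^ (-(D : ℝ) / 2) *
      Real.exp (-‖y - x‖ ^ 2 / (2 * σ ^ 2))))
    (y : EuclideanSpace ℝ (Fin D)) :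
    y + σ ^ 2 • gradient (fun v => Real.log (q v)) y =
      (∫ x, p x * Real.exp (-‖y - x‖ ^ 2 / (2 * σ ^ 2)))⁻¹ •
        ∫ x, (p x * Real.exp (-‖y - x‖ ^ 2 / (2 * σ ^ 2))) • x := by
  have hp : Integrable p := .of_integral_ne_zero (by simp [hp_int])
  set G : EuclideanSpace ℝ (Fin D) → ℝ :=
    fun v => ∫ x, p x * Real.exp (-‖v - x‖ ^ 2 / (2 * σ ^ 2)) with hG
  set C : ℝ := (2 * π * σ ^ 2) ^ (-(D : ℝ) / 2)
  have hC0 : C ≠ 0 := (Real.rpow_pos_of_pos (by positivity) _).ne'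
  have hG0 : ∀ v, G v ≠ 0 := fun v =>
    (integral_mul_exp_neg_norm_sub_sq_pos hp_nonneg (by simp [hp_int]) σ v).ne'
  have hlog : (fun v => Real.log (q v)) = fun v => Real.log C + Real.log (G v) := by
    ext v
    rw [← Real.log_mul hC0 (hG0 v), hq v, hG, ← integral_const_mul]
    simp only [mul_left_comm]
  have hgrad := hasGradientAt_integral_mul_exp_neg_norm_sub_sq hp hp_mom hσ.ne' y
  have hscore : gradient (fun v => Real.log (q v)) y = (G y)⁻¹ •
      ∫ x, (σ ^ 2)⁻¹ • (p x * Real.exp (-‖y - x‖ ^ 2 / (2 * σ ^ 2))) • (x - y) := by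
    apply HasGradientAt.gradient
    rw [hlog, hasGradientAt_iff_hasFDerivAt]
    refine ((hgrad.hasFDerivAt.log (hG0 y)).const_add (Real.log C)).congr_fderiv ?_
    ext w
    simp [G]
  rw [hscore, integral_smul]
  simp only [smul_sub]
  rw [integral_sub (integrable_mul_exp_neg_norm_sub_sq_smul hp hp_mom σ y)
    ((integrable_mul_exp_neg_norm_sub_sq hp σ y).smul_const y), integral_smul_const]
  change y + σ ^ 2 • (G y)⁻¹ • ((σ ^ 2)⁻¹ • (_ - G y • y)) = (G y)⁻¹ • _
  rw [smul_comm (σ ^ 2), smul_inv_smul₀ (by positivity), smul_sub, inv_smul_smul₀ (hG0 y),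
    add_sub_cancel]
end

section
/- (Tweedie's formula for denoising.) Let X be an integrable random vector in ℝ^D whose law has a probability density p with respect to Lebesgue measure, let Z be a standard Gaussian random vector in ℝ^D independent of X, let σ > 0, and set Y = X + σ·Z. Let q be the Lebesgue density of Y, given by q(y) = ∫ p(x) · (2πσ²)^{-D/2} · exp(-‖y - x‖²/(2σ²)) dx. Then the conditional expectation of X given the σ-algebra generated by Y satisfies, almost surely, E[X ∣ Y] = Y + σ² · ∇(log q)(Y). -/
open MeasureTheory ProbabilityTheory Real

/-- Bayes' formula: conditional expectation of `f X` given `Y` in terms of a joint density of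
`(X, Y)`. -/
theorem condExp_comp_ae_eq_of_map_prodMk_eq_withDensity {Ω α β G : Type*} [MeasurableSpace Ω]
    [MeasurableSpace α] [MeasurableSpace β] [NormedAddCommGroup G] [NormedSpace ℝ G]
    [CompleteSpace G] {μ : Measure Ω} [IsFiniteMeasure μ] {ν : Measure α} [SFinite ν]
    {ρ : Measure β} [SFinite ρ] {k : α × β → ℝ} (hk : Measurable k) (hk0 : 0 ≤ k)
    {X : Ω → α} {Y : Ω → β} (hX : Measurable X) (hY : Measurable Y)
    (hXY : μ.map (fun ω => (X ω, Y ω)) = (ν.prod ρ).withDensity fun z => ENNReal.ofReal (k z))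
    {f : α → G} (hf : StronglyMeasurable f) (hfX : Integrable (fun ω => f (X ω)) μ) :
    μ[fun ω => f (X ω) | MeasurableSpace.comap Y inferInstance] =ᵐ[μ]
      fun ω => (∫ x, k (x, Y ω) ∂ν)⁻¹ • ∫ x, k (x, Y ω) • f x ∂ν := by
  set q : β → ℝ := fun y => ∫ x, k (x, y) ∂ν
  set N : β → G := fun y => ∫ x, k (x, y) • f x ∂ν
  have hkf : StronglyMeasurable fun z : α × β => k z • f z.1 :=
    hk.stronglyMeasurable.smul (hf.comp_measurable measurable_fst)
  have hqm : StronglyMeasurable q := hk.stronglyMeasurable.integral_prod_left'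
  have hm : StronglyMeasurable fun y => (q y)⁻¹ • N y :=
    hqm.measurable.inv.stronglyMeasurable.smul hkf.integral_prod_left'
  have hq0 : 0 ≤ q := fun y => integral_nonneg fun x => hk0 _
  have hkm : Measurable fun z => ENNReal.ofReal (k z) := hk.ennreal_ofReal
  have hkint : Integrable k (ν.prod ρ) := by
    rw [← lintegral_ofReal_ne_top_iff_integrable hk.aestronglyMeasurable
      (ae_of_all _ hk0), ← setLIntegral_univ,
      ← withDensity_apply _ MeasurableSet.univ, ← hXY]
    exact measure_ne_top _ _
  have hkfint : Integrable (fun z : α × β => k z • f z.1) (ν.prod ρ) := by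
    have h : Integrable (fun z : α × β => f z.1) (μ.map fun ω => (X ω, Y ω)) :=
      (integrable_map_measure (hf.comp_measurable measurable_fst).aestronglyMeasurable
        (hX.prodMk hY).aemeasurable).2 hfX
    rw [hXY, integrable_withDensity_iff_integrable_smul' hkm
      (ae_of_all _ fun _ => ENNReal.ofReal_lt_top)] at h
    simpa only [ENNReal.toReal_ofReal (hk0 _)] using h
  have hYlaw : μ.map Y = ρ.withDensity fun y => ENNReal.ofReal (q y) := by
    have h : μ.map Y = (μ.map fun ω => (X ω, Y ω)).map Prod.snd := by
      rw [Measure.map_map measurable_snd (hX.prodMk hY)]; rfl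
    ext A hA
    rw [h, hXY, Measure.map_apply measurable_snd hA, withDensity_apply _ (measurable_snd hA),
      withDensity_apply _ hA, ← Set.univ_prod, ← Measure.prod_restrict, Measure.restrict_univ,
      lintegral_prod_symm' _ hkm]
    refine lintegral_congr_ae (ae_restrict_of_ae ?_)
    filter_upwards [hkint.prod_left_ae] with y hy
    exact (ofReal_integral_eq_lintegral_ofReal hy (ae_of_all _ fun x => hk0 _)).symm
  have hqN : (fun y => q y • (q y)⁻¹ • N y) =ᵐ[ρ] N := by
    filter_upwards [hkint.prod_left_ae] with y hy
    by_cases h : q y = 0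
    · have h0 := (integral_eq_zero_iff_of_nonneg (fun x => hk0 (x, y)) hy).1 h
      have hN0 : N y = 0 := by
        refine integral_eq_zero_of_ae ?_
        filter_upwards [h0] with x hx
        simp [show k (x, y) = 0 from hx]
      simp [hN0]
    · exact smul_inv_smul₀ h _
  have hmint : Integrable (fun ω => (q (Y ω))⁻¹ • N (Y ω)) μ := by
    refine (integrable_map_measure (g := fun y => (q y)⁻¹ • N y) hm.aestronglyMeasurable
      hY.aemeasurable).1 ?_
    rw [hYlaw, integrable_withDensity_iff_integrable_smul' hqm.measurable.ennreal_ofReal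
      (ae_of_all _ fun _ => ENNReal.ofReal_lt_top)]
    simp only [ENNReal.toReal_ofReal (hq0 _)]
    exact (integrable_congr hqN).2 hkfint.integral_prod_right
  refine (ae_eq_condExp_of_forall_setIntegral_eq hY.comap_le hfX
    (fun _ _ _ => hmint.integrableOn) ?_ ?_).symm
  · rintro _ ⟨A, hA, rfl⟩ -
    calc ∫ ω in Y ⁻¹' A, (q (Y ω))⁻¹ • N (Y ω) ∂μ
        = ∫ y in A, (q y)⁻¹ • N y ∂(μ.map Y) :=
          (setIntegral_map hA hm.aestronglyMeasurable hY.aemeasurable).symm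
      _ = ∫ y in A, q y • (q y)⁻¹ • N y ∂ρ := by
          rw [hYlaw, setIntegral_withDensity_eq_setIntegral_toReal_smul
            hqm.measurable.ennreal_ofReal (ae_of_all _ fun _ => ENNReal.ofReal_lt_top) _ hA]
          simp only [ENNReal.toReal_ofReal (hq0 _)]
      _ = ∫ y in A, N y ∂ρ := integral_congr_ae (ae_restrict_of_ae hqN)
      _ = ∫ z in Set.univ ×ˢ A, k z • f z.1 ∂(ν.prod ρ) := by
          have h := hkfint.integrableOn (s := Set.univ ×ˢ A)
          rw [IntegrableOn, ← Measure.prod_restrict, Measure.restrict_univ] at h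
          rw [← Measure.prod_restrict, Measure.restrict_univ, integral_prod_symm _ h]
      _ = ∫ z in Set.univ ×ˢ A, f z.1 ∂(μ.map fun ω => (X ω, Y ω)) := by
          rw [hXY, setIntegral_withDensity_eq_setIntegral_toReal_smul hkm
            (ae_of_all _ fun _ => ENNReal.ofReal_lt_top) _
            (MeasurableSet.univ.prod hA)]
          simp only [ENNReal.toReal_ofReal (hk0 _)]
      _ = ∫ ω in Y ⁻¹' A, f (X ω) ∂μ := by
          rw [setIntegral_map (f := fun z : α × β => f z.1) (MeasurableSet.univ.prod hA)
            (hf.comp_measurable measurable_fst).aestronglyMeasurable (hX.prodMk hY).aemeasurable,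
            Set.mk_preimage_prod, Set.preimage_univ, Set.univ_inter]
  · exact (hm.comp_measurable (comap_measurable Y)).aestronglyMeasurable

theorem mul_exp_neg_sq_le {s : ℝ} (hs : 0 < s) (t : ℝ) : t * exp (-t ^ 2 / (2 * s ^ 2)) ≤ s := by
  have h1 : t / s ≤ exp (t ^ 2 / (2 * s ^ 2)) := by
    have h2 := Real.add_one_le_exp (t ^ 2 / (2 * s ^ 2))
    have h3 : t ^ 2 / (2 * s ^ 2) = (t / s) ^ 2 / 2 := by field_simp
    nlinarith [sq_nonneg (t / s - 1)]
  rw [neg_div, Real.exp_neg, ← div_eq_mul_inv, div_le_iff₀ (exp_pos _)]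
  rwa [div_le_iff₀' hs] at h1

section Gaussian

variable {E : Type*} [NormedAddCommGroup E] [InnerProductSpace ℝ E]

theorem norm_gaussian_smul_le (c : ℝ) {s : ℝ} (hs : 0 < s) (u : E) :
    ‖(c * exp (-‖u‖ ^ 2 / (2 * s ^ 2))) • u‖ ≤ |c| * s := by
  rw [norm_smul, norm_mul, norm_eq_abs, norm_of_nonneg (exp_nonneg _), mul_assoc, mul_comm (exp _)]
  gcongr
  exact mul_exp_neg_sq_le hs _

theorem hasGradientAt_gaussian [CompleteSpace E] (c s : ℝ) (x y : E) :
    HasGradientAt (fun y => c * exp (-‖y - x‖ ^ 2 / (2 * s ^ 2)))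
      ((c * exp (-‖y - x‖ ^ 2 / (2 * s ^ 2))) • (s ^ 2)⁻¹ • (x - y)) y := by
  rw [hasGradientAt_iff_hasFDerivAt]
  have h1 : HasFDerivAt (fun y : E => ‖y - x‖ ^ 2) _ y := ((hasFDerivAt_id y).sub_const x).norm_sq
  have h2 := ((h1.neg.mul_const (2 * s ^ 2)⁻¹).exp).const_mul c
  simp only [← div_eq_mul_inv] at h2
  refine h2.congr_fderiv ?_
  ext v
  simp
  ring

variable [MeasurableSpace E] [BorelSpace E] [FiniteDimensional ℝ E] {ν : Measure E}

theorem integrable_mul_gaussian {p : E → ℝ} (hp : Integrable p ν) (c s : ℝ) (y : E) :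
    Integrable (fun x => p x * (c * exp (-‖y - x‖ ^ 2 / (2 * s ^ 2)))) ν := by
  refine hp.mul_bdd (c := |c|) (by fun_prop) (ae_of_all _ fun x => ?_)
  rw [norm_mul, norm_eq_abs, norm_of_nonneg (exp_nonneg _)]
  refine mul_le_of_le_one_right (abs_nonneg _) (exp_le_one_iff.2 ?_)
  rw [neg_div]
  exact neg_nonpos.2 (by positivity)

theorem integrable_mul_gaussian_smul_sub {p : E → ℝ} (hp : Integrable p ν) (c : ℝ) {s : ℝ}
    (hs : 0 < s) (y : E) :
    Integrable (fun x => (p x * (c * exp (-‖y - x‖ ^ 2 / (2 * s ^ 2)))) • (x - y)) ν := by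
  simp only [mul_smul (p _)]
  refine hp.smul_bdd (|c| * s) (by fun_prop) (ae_of_all _ fun x => ?_)
  rw [norm_sub_rev y x]
  exact norm_gaussian_smul_le c hs _

theorem hasGradientAt_integral_mul_gaussian {p : E → ℝ} (hp : Integrable p ν) (c : ℝ) {s : ℝ}
    (hs : 0 < s) (y : E) :
    HasGradientAt (fun y => ∫ x, p x * (c * exp (-‖y - x‖ ^ 2 / (2 * s ^ 2))) ∂ν)
      ((s ^ 2)⁻¹ • ∫ x, (p x * (c * exp (-‖y - x‖ ^ 2 / (2 * s ^ 2)))) • (x - y) ∂ν) y := by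
  rw [hasGradientAt_iff_hasFDerivAt]
  let L : E →L[ℝ] E →L[ℝ] ℝ := innerSL ℝ
  let v (y x : E) : E :=
    (s ^ 2)⁻¹ • (p x * (c * exp (-‖y - x‖ ^ 2 / (2 * s ^ 2)))) • (x - y)
  have hv (y : E) : Integrable (v y) ν := (integrable_mul_gaussian_smul_sub hp c hs y).smul _
  have key := hasFDerivAt_integral_of_dominated_of_fderiv_le (μ := ν) (𝕜 := ℝ)
    (F := fun y x => p x * (c * exp (-‖y - x‖ ^ 2 / (2 * s ^ 2))))
    (F' := fun y x => L (v y x))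
    (bound := fun x => (s ^ 2)⁻¹ * (|p x| * (|c| * s))) (x₀ := y) Filter.univ_mem
    (Filter.Eventually.of_forall fun y => (integrable_mul_gaussian hp c s y).aestronglyMeasurable)
    (integrable_mul_gaussian hp c s y)
    (L.continuous.comp_aestronglyMeasurable (hv y).aestronglyMeasurable)
    (ae_of_all _ fun x y _ => ?_)
    ((hp.abs.mul_const _).const_mul _)
    (ae_of_all _ fun x y _ => ?_)
  · refine key.congr_fderiv ?_
    rw [L.integral_comp_comm (hv y), integral_smul]
    rfl
  · rw [innerSL_apply_norm, norm_smul, mul_smul, norm_smul,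
      norm_of_nonneg (by positivity : 0 ≤ (s ^ 2)⁻¹), norm_eq_abs, norm_sub_rev y x]
    gcongr
    exact norm_gaussian_smul_le c hs _
  · refine ((hasGradientAt_gaussian c s x y).hasFDerivAt.const_mul (p x)).congr_fderiv ?_
    ext w
    have hL (a : E) : L a w = inner ℝ a w := rfl
    simp only [hL, v, inner_smul_left, inner_sub_left, InnerProductSpace.toDual_apply_apply,
      smul_apply, smul_eq_mul, conj_trivial]
    ring

theorem integral_mul_gaussian_pos {p : E → ℝ} (hp : Integrable p ν) (hp0 : 0 ≤ p)
    (hpos : 0 < ∫ x, p x ∂ν) {c : ℝ} (hc : 0 < c) (s : ℝ) (y : E) :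
    0 < ∫ x, p x * (c * exp (-‖y - x‖ ^ 2 / (2 * s ^ 2))) ∂ν := by
  rw [integral_pos_iff_support_of_nonneg hp0 hp] at hpos
  rw [integral_pos_iff_support_of_nonneg (fun x => mul_nonneg (hp0 x) (by positivity))
    (integrable_mul_gaussian hp c s y)]
  convert hpos using 2
  ext x
  simp [hc.ne', (exp_pos _).ne']

/-- The mean of the posterior with prior density `p` and Gaussian likelihood, in terms of the score
of the Gaussian-smoothed density. -/
theorem inv_smul_integral_mul_gaussian_smul_eq {p : E → ℝ} (hp : Integrable p ν) (hp0 : 0 ≤ p)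
    (hpos : 0 < ∫ x, p x ∂ν) {c : ℝ} (hc : 0 < c) {s : ℝ} (hs : 0 < s) (y : E) :
    (∫ x, p x * (c * exp (-‖y - x‖ ^ 2 / (2 * s ^ 2))) ∂ν)⁻¹ •
        ∫ x, (p x * (c * exp (-‖y - x‖ ^ 2 / (2 * s ^ 2)))) • x ∂ν =
      y + s ^ 2 • gradient
        (fun v => log (∫ x, p x * (c * exp (-‖v - x‖ ^ 2 / (2 * s ^ 2))) ∂ν)) y := by
  have hq := integral_mul_gaussian_pos hp hp0 hpos hc s y
  have hgrad := (hasGradientAt_integral_mul_gaussian hp c hs y).hasFDerivAt.log hq.ne'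
  rw [← map_smul, hasFDerivAt_iff_hasGradientAt, LinearIsometryEquiv.symm_apply_apply] at hgrad
  have hsplit : ∫ x, (p x * (c * exp (-‖y - x‖ ^ 2 / (2 * s ^ 2)))) • x ∂ν =
      ∫ x, (p x * (c * exp (-‖y - x‖ ^ 2 / (2 * s ^ 2)))) • (x - y) ∂ν +
        (∫ x, p x * (c * exp (-‖y - x‖ ^ 2 / (2 * s ^ 2))) ∂ν) • y := by
    rw [← integral_smul_const, ← integral_add (integrable_mul_gaussian_smul_sub hp c hs y)
      ((integrable_mul_gaussian hp c s y).smul_const y)]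
    simp only [← smul_add, sub_add_cancel]
  rw [hgrad.gradient, hsplit, smul_add, inv_smul_smul₀ hq.ne', add_comm, smul_comm (s ^ 2),
    smul_inv_smul₀ (by positivity)]

theorem lintegral_comp_add_smul (ν : Measure E) [ν.IsAddHaarMeasure] {f : E → ENNReal}
    (hf : Measurable f) {r : ℝ} (hr : 0 < r) (x : E) :
    ∫⁻ z, f (x + r • z) ∂ν = ENNReal.ofReal (r ^ Module.finrank ℝ E)⁻¹ * ∫⁻ y, f y ∂ν := by
  rw [← lintegral_add_left_eq_self f x,
    ← lintegral_map (f := fun y => f (x + y)) (g := fun z => r • z) (by fun_prop) (by fun_prop),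
    Measure.map_addHaar_smul ν hr.ne', lintegral_smul_measure, abs_of_nonneg (by positivity)]
  rfl

/-- Joint density of `(X, X + r • Z)` for independent `X` and `Z` with given densities. -/
theorem map_prodMk_add_smul_eq_withDensity {Ω : Type*} [MeasurableSpace Ω] {μ : Measure Ω}
    [IsFiniteMeasure μ] [ν.IsAddHaarMeasure] {X Z : Ω → E} (hX : Measurable X) (hZ : Measurable Z)
    (hindep : IndepFun X Z μ) {f g : E → ENNReal} (hf : Measurable f) (hg : Measurable g)
    (hXlaw : μ.map X = ν.withDensity f) (hZlaw : μ.map Z = ν.withDensity g)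
    {r : ℝ} (hr : 0 < r) :
    μ.map (fun ω => (X ω, X ω + r • Z ω)) = (ν.prod ν).withDensity fun z =>
      f z.1 * (ENNReal.ofReal (r ^ Module.finrank ℝ E)⁻¹ * g (r⁻¹ • (z.2 - z.1))) := by
  have hcomp : (fun ω => (X ω, X ω + r • Z ω)) =
      (fun z : E × E => (z.1, z.1 + r • z.2)) ∘ fun ω => (X ω, Z ω) := rfl
  refine Measure.ext_of_lintegral _ fun F hF => ?_
  rw [hcomp, ← Measure.map_map (by fun_prop) (hX.prodMk hZ),
    (indepFun_iff_map_prod_eq_prod_map_map hX.aemeasurable hZ.aemeasurable).1 hindep, hXlaw, hZlaw,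
    prod_withDensity hf hg, lintegral_map hF (by fun_prop),
    lintegral_withDensity_eq_lintegral_mul _ (by fun_prop) (by fun_prop),
    lintegral_withDensity_eq_lintegral_mul _ (by fun_prop) hF,
    lintegral_prod _ (by fun_prop), lintegral_prod _ (by fun_prop)]
  refine lintegral_congr fun x => ?_
  simp only [Pi.mul_apply, mul_assoc]
  rw [lintegral_const_mul _ (by fun_prop), lintegral_const_mul _ (by fun_prop),
    lintegral_const_mul _ (by fun_prop), ← lintegral_comp_add_smul ν (by fun_prop) hr x]
  simp only [add_sub_cancel_left, inv_smul_smul₀ hr.ne']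

end Gaussian

/-- Tweedie's formula for denoising: if `Y = X + σ • Z` with `X` an integrable random vector
with Lebesgue density `p`, `Z` an independent standard Gaussian, and `q` the (Gaussian-smoothed)
density of `Y`, then almost surely `E[X ∣ Y] = Y + σ² • ∇(log q)(Y)`. -/
theorem tweedie_formula
    {D : ℕ} {Ω : Type*} [MeasurableSpace Ω] {μ : Measure Ω} [IsProbabilityMeasure μ]
    (p : EuclideanSpace ℝ (Fin D) → ℝ)
    (hp_meas : Measurable p) (hp_nonneg : ∀ x, 0 ≤ p x)
    (hp_int : ∫ x, p x = 1)
    (σ : ℝ) (hσ : 0 < σ)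
    (X Z : Ω → EuclideanSpace ℝ (Fin D))
    (hX : Measurable X) (hZ : Measurable Z)
    (hXint : Integrable X μ)
    (hXlaw : Measure.map X μ = volume.withDensity (fun x => ENNReal.ofReal (p x)))
    (hZlaw : Measure.map Z μ = volume.withDensity (fun z =>
      ENNReal.ofReal ((2 * π) ^ (-(D : ℝ) / 2) * Real.exp (-‖z‖ ^ 2 / 2))))
    (hindep : IndepFun X Z μ)
    (Y : Ω → EuclideanSpace ℝ (Fin D))
    (hY : ∀ ω, Y ω = X ω + σ • Z ω)
    (q : EuclideanSpace ℝ (Fin D) → ℝ)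
    (hq : ∀ y, q y = ∫ x, p x * ((2 * π * σ ^ 2) ^ (-(D : ℝ) / 2) *
      Real.exp (-‖y - x‖ ^ 2 / (2 * σ ^ 2)))) :
    μ[X | MeasurableSpace.comap Y inferInstance] =ᵐ[μ]
      fun ω => Y ω + σ ^ 2 • gradient (fun v => Real.log (q v)) (Y ω) := by
  have hp : Integrable p := .of_integral_ne_zero (by simp [hp_int])
  have hY' : Y = fun ω => X ω + σ • Z ω := funext hY
  have hYm : Measurable Y := by rw [hY']; fun_prop
  have hc : 0 < (2 * π * σ ^ 2) ^ (-(D : ℝ) / 2) := by positivity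
  have hscale (u : EuclideanSpace ℝ (Fin D)) :
      (σ ^ D)⁻¹ * ((2 * π) ^ (-(D : ℝ) / 2) * exp (-‖σ⁻¹ • u‖ ^ 2 / 2)) =
        (2 * π * σ ^ 2) ^ (-(D : ℝ) / 2) * exp (-‖u‖ ^ 2 / (2 * σ ^ 2)) := by
    have h1 : (σ ^ 2) ^ (-(D : ℝ) / 2) = (σ ^ D)⁻¹ := by
      rw [← rpow_natCast σ 2, ← rpow_mul hσ.le, ← rpow_natCast σ D, ← rpow_neg hσ.le]
      congr 1
      push_cast
      ring
    have h2 : -‖σ⁻¹ • u‖ ^ 2 / 2 = -‖u‖ ^ 2 / (2 * σ ^ 2) := by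
      rw [norm_smul, norm_inv, norm_of_nonneg hσ.le]
      field_simp
    rw [mul_rpow (by positivity : 0 ≤ 2 * π) (by positivity), h1, h2]
    ring
  have hjoint : μ.map (fun ω => (X ω, Y ω)) = (volume.prod volume).withDensity fun z =>
      ENNReal.ofReal (p z.1 * ((2 * π * σ ^ 2) ^ (-(D : ℝ) / 2) *
        exp (-‖z.2 - z.1‖ ^ 2 / (2 * σ ^ 2)))) := by
    rw [hY', map_prodMk_add_smul_eq_withDensity hX hZ hindep (by fun_prop) (by fun_prop)
      hXlaw hZlaw hσ]
    congr 1
    ext z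
    rw [finrank_euclideanSpace_fin, ← ENNReal.ofReal_mul (by positivity),
      ← ENNReal.ofReal_mul (hp_nonneg _), hscale]
  have hbayes := condExp_comp_ae_eq_of_map_prodMk_eq_withDensity (f := id)
    (k := fun z => p z.1 * ((2 * π * σ ^ 2) ^ (-(D : ℝ) / 2) *
      exp (-‖z.2 - z.1‖ ^ 2 / (2 * σ ^ 2)))) (by fun_prop)
    (fun z => mul_nonneg (hp_nonneg _) (by positivity)) hX hYm hjoint stronglyMeasurable_id hXint
  refine hbayes.trans (Filter.Eventually.of_forall fun ω => ?_)
  simp only [funext hq]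
  exact inv_smul_integral_mul_gaussian_smul_eq hp hp_nonneg (by simp [hp_int]) hc hσ (Y ω)
end

section
/- (Score equals negative normalized expected noise.) Let X be an integrable random vector in ℝ^D whose law has a probability density p with respect to Lebesgue measure, let Z be a standard Gaussian random vector in ℝ^D independent of X, let σ > 0, and set Y = X + σ·Z. Let q be the Lebesgue density of Y. Then, almost surely, ∇(log q)(Y) = −(1/σ) · E[Z ∣ Y]; equivalently, the score of the smoothed density evaluated at the noisy observation equals minus the conditional expectation of the injected noise divided by the noise scale. -/
open MeasureTheory ProbabilityTheory Real

theorem MeasureTheory.Measure.map_withDensity_comp {α β : Type*} [MeasurableSpace α]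
    [MeasurableSpace β] {ν : Measure α} {T : α → β} (hT : Measurable T) {f : β → ENNReal}
    (hf : Measurable f) :
    (ν.withDensity (fun a => f (T a))).map T = (ν.map T).withDensity f := by
  ext s hs
  rw [Measure.map_apply hT hs, withDensity_apply _ (hT hs), withDensity_apply _ hs,
    setLIntegral_map hs hf hT]

/-- Bayes' formula for conditional expectations: if `(X, Y)` has joint density `k`, then
`E[f(X, Y) ∣ Y]` is the `k`-weighted average of `f(·, Y)`. -/
theorem ProbabilityTheory.condExp_ae_eq_of_joint_density {Ω α β E : Type*} [MeasurableSpace Ω]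
    [MeasurableSpace α] [MeasurableSpace β] [NormedAddCommGroup E] [NormedSpace ℝ E]
    [CompleteSpace E] {μ : Measure Ω} [IsFiniteMeasure μ] {ν : Measure α} {ρ : Measure β}
    [SFinite ν] [SFinite ρ] {X : Ω → α} {Y : Ω → β} (hX : Measurable X) (hY : Measurable Y)
    {k : α × β → ℝ} (hk : Measurable k) (hk_nonneg : ∀ a, 0 ≤ k a)
    (hk_pos : ∀ y, 0 < ∫ x, k (x, y) ∂ν)
    (hlaw : μ.map (fun ω => (X ω, Y ω)) = (ν.prod ρ).withDensity (fun a => ENNReal.ofReal (k a)))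
    {f : α × β → E} (hf : StronglyMeasurable f) (hf_int : Integrable (fun ω => f (X ω, Y ω)) μ) :
    (fun ω => (∫ x, k (x, Y ω) ∂ν)⁻¹ • ∫ x, k (x, Y ω) • f (x, Y ω) ∂ν) =ᵐ[μ]
      μ[fun ω => f (X ω, Y ω) | MeasurableSpace.comap Y inferInstance] := by
  have hXY : Measurable (fun ω => (X ω, Y ω)) := hX.prodMk hY
  set q : β → ℝ := fun y => ∫ x, k (x, y) ∂ν with hq
  set h : β → E := fun y => ∫ x, k (x, y) • f (x, y) ∂ν with hh
  have hk_int : ∀ y, Integrable (fun x => k (x, y)) ν := fun y => by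
    by_contra hn
    exact (hk_pos y).ne' (integral_undef hn)
  have hkE : Measurable (fun a => ENNReal.ofReal (k a)) := hk.ennreal_ofReal
  have hqm : StronglyMeasurable q :=
    StronglyMeasurable.integral_prod_left (f := fun x y => k (x, y)) hk.stronglyMeasurable
  have hhm : StronglyMeasurable h :=
    StronglyMeasurable.integral_prod_left (f := fun x y => k (x, y) • f (x, y))
      (hk.stronglyMeasurable.smul hf)
  have hφm : StronglyMeasurable (fun y => (q y)⁻¹ • h y) :=
    hqm.measurable.inv.stronglyMeasurable.smul hhm
  have hqE : Measurable (fun y => ENNReal.ofReal (q y)) := hqm.measurable.ennreal_ofReal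
  have hYlaw : μ.map Y = ρ.withDensity (fun y => ENNReal.ofReal (q y)) := by
    ext s hs
    have h1 : μ.map Y s = μ.map (fun ω => (X ω, Y ω)) (Prod.snd ⁻¹' s) := by
      rw [Measure.map_apply hY hs, Measure.map_apply hXY (measurable_snd hs)]
      rfl
    rw [h1, hlaw, withDensity_apply _ (measurable_snd hs), withDensity_apply _ hs,
      ← Set.univ_prod, ← Measure.prod_restrict, Measure.restrict_univ,
      lintegral_prod_symm' _ hkE]
    refine lintegral_congr fun y => ?_
    exact (ofReal_integral_eq_lintegral_ofReal (hk_int y)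
      (Filter.Eventually.of_forall fun x => hk_nonneg _)).symm
  have hkf : Integrable (fun a => k a • f a) (ν.prod ρ) := by
    have h1 : Integrable f (μ.map (fun ω => (X ω, Y ω))) :=
      (integrable_map_measure hf.aestronglyMeasurable hXY.aemeasurable).2 hf_int
    rw [hlaw, integrable_withDensity_iff_integrable_smul' hkE (by simp)] at h1
    simpa only [ENNReal.toReal_ofReal (hk_nonneg _)] using h1
  have hh_int : Integrable h ρ := hkf.integral_prod_right
  have hq_nonneg : ∀ y, 0 ≤ q y := fun y => (hk_pos y).le
  have hq_smul : ∀ y, (ENNReal.ofReal (q y)).toReal • (q y)⁻¹ • h y = h y := fun y => by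
    rw [ENNReal.toReal_ofReal (hq_nonneg y), smul_inv_smul₀ (hk_pos y).ne']
  have hφ_int : Integrable (fun ω => (q (Y ω))⁻¹ • h (Y ω)) μ := by
    refine (integrable_map_measure (f := Y) (g := fun y => (q y)⁻¹ • h y)
      hφm.aestronglyMeasurable hY.aemeasurable).1 ?_
    rw [hYlaw, integrable_withDensity_iff_integrable_smul' hqE (by simp)]
    simpa only [hq_smul] using hh_int
  refine ae_eq_condExp_of_forall_setIntegral_eq hY.comap_le hf_int
    (fun _ _ _ => hφ_int.integrableOn) ?_ ?_
  · rintro _ ⟨s, hs, rfl⟩ -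
    have hL : ∫ ω in Y ⁻¹' s, (q (Y ω))⁻¹ • h (Y ω) ∂μ = ∫ y in s, h y ∂ρ := by
      rw [← setIntegral_map (f := fun y => (q y)⁻¹ • h y) hs hφm.aestronglyMeasurable
        hY.aemeasurable, hYlaw, setIntegral_withDensity_eq_setIntegral_toReal_smul hqE (by simp) _ hs]
      simp only [hq_smul]
    have hR : ∫ ω in Y ⁻¹' s, f (X ω, Y ω) ∂μ = ∫ y in s, h y ∂ρ := by
      have h1 := setIntegral_map (μ := μ) (measurable_snd (α := α) hs) hf.aestronglyMeasurable
        hXY.aemeasurable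
      rw [hlaw, setIntegral_withDensity_eq_setIntegral_toReal_smul hkE (by simp) _
        (measurable_snd hs)] at h1
      simp only [ENNReal.toReal_ofReal (hk_nonneg _)] at h1
      refine h1.symm.trans ?_
      have h2 : (ν.prod ρ).restrict (Prod.snd ⁻¹' s) = ν.prod (ρ.restrict s) := by
        rw [← Set.univ_prod, ← Measure.prod_restrict, Measure.restrict_univ]
      have h3 := hkf.integrableOn (s := Prod.snd ⁻¹' s)
      rw [IntegrableOn, h2] at h3
      rw [h2, integral_prod_symm _ h3]
    exact hL.trans hR.symm
  · exact (hφm.comp_measurable (comap_measurable Y)).aestronglyMeasurable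

section Gaussian

variable {D : ℕ}

/-- The density of the centred Gaussian on `ℝ^D` with covariance `σ² I`. -/
noncomputable def isotropicGaussianPDF (σ : ℝ) (w : EuclideanSpace ℝ (Fin D)) : ℝ :=
  (2 * π * σ ^ 2) ^ (-(D : ℝ) / 2) * Real.exp (-‖w‖ ^ 2 / (2 * σ ^ 2))

theorem continuous_isotropicGaussianPDF (σ : ℝ) :
    Continuous (isotropicGaussianPDF (D := D) σ) := by
  unfold isotropicGaussianPDF
  fun_prop

theorem measurable_isotropicGaussianPDF (σ : ℝ) :
    Measurable (isotropicGaussianPDF (D := D) σ) :=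
  (continuous_isotropicGaussianPDF σ).measurable

theorem isotropicGaussianPDF_pos {σ : ℝ} (hσ : 0 < σ) (w : EuclideanSpace ℝ (Fin D)) :
    0 < isotropicGaussianPDF σ w := by
  unfold isotropicGaussianPDF
  positivity

theorem isotropicGaussianPDF_le (σ : ℝ) (w : EuclideanSpace ℝ (Fin D)) :
    isotropicGaussianPDF σ w ≤ (2 * π * σ ^ 2) ^ (-(D : ℝ) / 2) := by
  unfold isotropicGaussianPDF
  refine mul_le_of_le_one_right (by positivity) (Real.exp_le_one_iff.2 ?_)
  rw [neg_div]
  exact neg_nonpos.2 (by positivity)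

theorem mul_exp_neg_sq_div_le {c : ℝ} (hc : 0 < c) (t : ℝ) :
    t * Real.exp (-t ^ 2 / (2 * c ^ 2)) ≤ c := by
  have h1 : t ≤ c * Real.exp (t ^ 2 / (2 * c ^ 2)) := by
    have h2 := Real.add_one_le_exp (t ^ 2 / (2 * c ^ 2))
    have h3 : t ≤ c * (t ^ 2 / (2 * c ^ 2) + 1) := by
      have h4 : c * (t ^ 2 / (2 * c ^ 2) + 1) - t = ((t - c) ^ 2 + c ^ 2) / (2 * c) := by
        field_simp
        ring
      have h5 : 0 ≤ ((t - c) ^ 2 + c ^ 2) / (2 * c) := by positivity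
      linarith
    exact h3.trans (mul_le_mul_of_nonneg_left h2 hc.le)
  rw [neg_div, Real.exp_neg, ← div_eq_mul_inv]
  exact (div_le_iff₀ (Real.exp_pos _)).2 h1

theorem isotropicGaussianPDF_mul_norm_le {σ : ℝ} (hσ : 0 < σ) (w : EuclideanSpace ℝ (Fin D)) :
    isotropicGaussianPDF σ w * ‖w‖ ≤ (2 * π * σ ^ 2) ^ (-(D : ℝ) / 2) * σ := by
  unfold isotropicGaussianPDF
  rw [mul_assoc, mul_comm (Real.exp _)]
  exact mul_le_mul_of_nonneg_left (mul_exp_neg_sq_div_le hσ _) (by positivity)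

theorem hasFDerivAt_isotropicGaussianPDF (σ : ℝ) (w : EuclideanSpace ℝ (Fin D)) :
    HasFDerivAt (isotropicGaussianPDF (D := D) σ)
      ((-(1 / σ ^ 2) * isotropicGaussianPDF σ w) • innerSL ℝ w) w := by
  have h1 : HasFDerivAt (fun w : EuclideanSpace ℝ (Fin D) => ‖w‖ ^ 2) (2 • innerSL ℝ w) w :=
    (hasStrictFDerivAt_norm_sq w).hasFDerivAt
  have h2 := ((h1.neg.mul_const ((2 * σ ^ 2)⁻¹)).exp).const_mul ((2 * π * σ ^ 2) ^ (-(D : ℝ) / 2))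
  refine (h2.congr_fderiv ?_).congr_of_eventuallyEq (.of_forall fun v => ?_)
  · ext v
    by_cases hσ : σ = 0
    · simp [hσ]
    · simp [isotropicGaussianPDF, div_eq_mul_inv]
      field_simp
  · simp [isotropicGaussianPDF, div_eq_mul_inv]

theorem integrable_exp_neg_mul_norm_sq {b : ℝ} (hb : 0 < b) :
    Integrable (fun w : EuclideanSpace ℝ (Fin D) => Real.exp (-b * ‖w‖ ^ 2)) := by
  have h := (GaussianFourier.integrable_cexp_neg_mul_sq_norm_add (V := EuclideanSpace ℝ (Fin D))
    (b := (b : ℂ)) (by simpa using hb) 0 0).norm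
  refine h.congr (.of_forall fun w => ?_)
  have h1 : (-(b : ℂ) * (‖w‖ : ℂ) ^ 2 + 0 * ((inner ℝ (0 : EuclideanSpace ℝ (Fin D)) w : ℝ) : ℂ)) =
      ((-b * ‖w‖ ^ 2 : ℝ) : ℂ) := by
    push_cast
    ring
  beta_reduce
  rw [h1, Complex.norm_exp_ofReal]

theorem integrable_isotropicGaussianPDF_smul_self {σ : ℝ} (hσ : 0 < σ) :
    Integrable (fun w : EuclideanSpace ℝ (Fin D) => isotropicGaussianPDF σ w • w) := by
  have hb : 0 < (4 * σ ^ 2)⁻¹ := by positivity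
  have h := (integrable_exp_neg_mul_norm_sq (D := D) hb).const_mul
    ((2 * π * σ ^ 2) ^ (-(D : ℝ) / 2) * (√2 * σ))
  refine h.mono' ((continuous_isotropicGaussianPDF σ).smul continuous_id).aestronglyMeasurable
    (.of_forall fun w => ?_)
  have h1 := mul_exp_neg_sq_div_le (c := √2 * σ) (by positivity) ‖w‖
  have h2 : Real.exp (-‖w‖ ^ 2 / (2 * σ ^ 2)) =
      Real.exp (-‖w‖ ^ 2 / (2 * (√2 * σ) ^ 2)) * Real.exp (-(4 * σ ^ 2)⁻¹ * ‖w‖ ^ 2) := by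
    rw [← Real.exp_add]
    congr 1
    rw [mul_pow, Real.sq_sqrt (by norm_num)]
    field_simp
    ring
  rw [norm_smul, Real.norm_of_nonneg (isotropicGaussianPDF_pos hσ w).le, isotropicGaussianPDF, h2]
  calc _ = (2 * π * σ ^ 2) ^ (-(D : ℝ) / 2) *
        (‖w‖ * Real.exp (-‖w‖ ^ 2 / (2 * (√2 * σ) ^ 2))) * Real.exp (-(4 * σ ^ 2)⁻¹ * ‖w‖ ^ 2) := by
        ring
    _ ≤ _ := by gcongr

theorem isotropicGaussianPDF_one_eq {σ : ℝ} (hσ : 0 < σ) (z : EuclideanSpace ℝ (Fin D)) :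
    isotropicGaussianPDF 1 z = σ ^ D * isotropicGaussianPDF σ (σ • z) := by
  have h1 : (σ ^ 2) ^ (-(D : ℝ) / 2) = (σ ^ D)⁻¹ := by
    rw [← Real.rpow_natCast σ 2, ← Real.rpow_mul hσ.le, ← Real.rpow_natCast σ D,
      ← Real.rpow_neg hσ.le]
    congr 1
    push_cast
    ring
  have h2 : -(σ * ‖z‖) ^ 2 / (2 * σ ^ 2) = -‖z‖ ^ 2 / (2 * 1 ^ 2) := by
    field_simp
  rw [isotropicGaussianPDF, isotropicGaussianPDF, norm_smul, Real.norm_of_nonneg hσ.le, h2,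
    Real.mul_rpow (y := σ ^ 2) (by positivity) (by positivity), h1, one_pow, mul_one]
  field_simp

theorem map_smul_withDensity_isotropicGaussianPDF {σ : ℝ} (hσ : 0 < σ) :
    ((volume : Measure (EuclideanSpace ℝ (Fin D))).withDensity
      (fun z => ENNReal.ofReal (isotropicGaussianPDF 1 z))).map (fun z => σ • z) =
    volume.withDensity (fun w => ENNReal.ofReal (isotropicGaussianPDF σ w)) := by
  have hm : Measurable (fun w : EuclideanSpace ℝ (Fin D) =>
      ENNReal.ofReal (isotropicGaussianPDF σ w)) :=
    (measurable_isotropicGaussianPDF σ).ennreal_ofReal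
  have h1 : (fun z : EuclideanSpace ℝ (Fin D) => ENNReal.ofReal (isotropicGaussianPDF 1 z)) =
      ENNReal.ofReal (σ ^ D) • fun z => ENNReal.ofReal (isotropicGaussianPDF σ (σ • z)) := by
    ext z
    rw [isotropicGaussianPDF_one_eq hσ, ENNReal.ofReal_mul (by positivity)]
    rfl
  rw [h1, withDensity_smul (f := fun z : EuclideanSpace ℝ (Fin D) =>
    ENNReal.ofReal (isotropicGaussianPDF σ (σ • z))) _ (hm.comp (measurable_const_smul σ)), Measure.map_smul,
    Measure.map_withDensity_comp (measurable_const_smul σ) hm,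
    Measure.map_addHaar_smul _ hσ.ne', withDensity_smul_measure, smul_smul,
    ← ENNReal.ofReal_mul (by positivity), finrank_euclideanSpace_fin,
    abs_of_pos (by positivity), mul_inv_cancel₀ (by positivity), ENNReal.ofReal_one, one_smul]

theorem integrable_mul_isotropicGaussianPDF_sub {p : EuclideanSpace ℝ (Fin D) → ℝ}
    (hp : Integrable p) {σ : ℝ} (hσ : 0 < σ) (y : EuclideanSpace ℝ (Fin D)) :
    Integrable (fun x => p x * isotropicGaussianPDF σ (y - x)) := by
  refine hp.mul_bdd (c := (2 * π * σ ^ 2) ^ (-(D : ℝ) / 2))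
    ((continuous_isotropicGaussianPDF σ).comp (continuous_const.sub continuous_id)
      ).aestronglyMeasurable (.of_forall fun x => ?_)
  rw [Real.norm_of_nonneg (isotropicGaussianPDF_pos hσ _).le]
  exact isotropicGaussianPDF_le σ _

theorem integral_mul_isotropicGaussianPDF_sub_pos {p : EuclideanSpace ℝ (Fin D) → ℝ}
    (hp : Integrable p) (hp_nonneg : ∀ x, 0 ≤ p x) (hp_pos : 0 < ∫ x, p x) {σ : ℝ} (hσ : 0 < σ)
    (y : EuclideanSpace ℝ (Fin D)) :
    0 < ∫ x, p x * isotropicGaussianPDF σ (y - x) := by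
  rw [integral_pos_iff_support_of_nonneg
    (fun x => mul_nonneg (hp_nonneg x) (isotropicGaussianPDF_pos hσ _).le)
    (integrable_mul_isotropicGaussianPDF_sub hp hσ y)]
  have h1 : Function.support (fun x => p x * isotropicGaussianPDF σ (y - x)) =
      Function.support p := by
    ext x
    simp [(isotropicGaussianPDF_pos hσ (y - x)).ne']
  rw [h1]
  exact (integral_pos_iff_support_of_nonneg hp_nonneg hp).1 hp_pos

theorem integrable_mul_isotropicGaussianPDF_sub_smul {p : EuclideanSpace ℝ (Fin D) → ℝ}
    (hp : Integrable p) {σ : ℝ} (hσ : 0 < σ) (y : EuclideanSpace ℝ (Fin D)) :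
    Integrable (fun x => (p x * isotropicGaussianPDF σ (y - x)) • (y - x)) := by
  have hc : Continuous (fun x : EuclideanSpace ℝ (Fin D) => y - x) := by fun_prop
  refine (hp.norm.mul_const ((2 * π * σ ^ 2) ^ (-(D : ℝ) / 2) * σ)).mono'
    ((hp.aestronglyMeasurable.mul
      ((continuous_isotropicGaussianPDF σ).comp hc).aestronglyMeasurable).smul
      hc.aestronglyMeasurable) (.of_forall fun x => ?_)
  rw [norm_smul, norm_mul, mul_assoc, Real.norm_of_nonneg (isotropicGaussianPDF_pos hσ _).le]
  exact mul_le_mul_of_nonneg_left (isotropicGaussianPDF_mul_norm_le hσ _) (norm_nonneg _)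

theorem hasGradientAt_integral_mul_isotropicGaussianPDF {p : EuclideanSpace ℝ (Fin D) → ℝ}
    (hp : Integrable p) {σ : ℝ} (hσ : 0 < σ) (y : EuclideanSpace ℝ (Fin D)) :
    HasGradientAt (fun v => ∫ x, p x * isotropicGaussianPDF σ (v - x))
      (-(1 / σ ^ 2) • ∫ x, (p x * isotropicGaussianPDF σ (y - x)) • (y - x)) y := by
  rw [hasGradientAt_iff_hasFDerivAt]
  have hint := integrable_mul_isotropicGaussianPDF_sub_smul hp hσ y
  have h := hasFDerivAt_integral_of_dominated_of_fderiv_le (𝕜 := ℝ) (μ := volume) (x₀ := y)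
    (F := fun v x => p x * isotropicGaussianPDF σ (v - x))
    (F' := fun v x => innerSL ℝ (-(1 / σ ^ 2) • (p x * isotropicGaussianPDF σ (v - x)) • (v - x)))
    (bound := fun x => 1 / σ ^ 2 * (‖p x‖ * ((2 * π * σ ^ 2) ^ (-(D : ℝ) / 2) * σ)))
    Filter.univ_mem
    (.of_forall fun v => (integrable_mul_isotropicGaussianPDF_sub hp hσ v).aestronglyMeasurable)
    (integrable_mul_isotropicGaussianPDF_sub hp hσ y)
    ((innerSL ℝ).continuous.comp_aestronglyMeasurable
      (hint.smul (-(1 / σ ^ 2))).aestronglyMeasurable)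
    (.of_forall fun x v _ => ?_)
    ((hp.norm.mul_const _).const_mul _)
    (.of_forall fun x v _ => ?_)
  · refine h.congr_fderiv ?_
    rw [← integral_smul]
    exact ContinuousLinearMap.integral_comp_comm (innerSL ℝ) (hint.smul (-(1 / σ ^ 2)))
  · rw [innerSL_apply_norm, norm_smul, norm_smul, norm_mul, norm_neg, mul_assoc ‖p x‖,
      Real.norm_of_nonneg (isotropicGaussianPDF_pos hσ _).le,
      Real.norm_of_nonneg (show 0 ≤ 1 / σ ^ 2 by positivity)]
    gcongr 1 / σ ^ 2 * ?_
    exact mul_le_mul_of_nonneg_left (isotropicGaussianPDF_mul_norm_le hσ _) (norm_nonneg _)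
  · have h1 := ((hasFDerivAt_isotropicGaussianPDF σ (v - x)).comp v
      ((hasFDerivAt_id v).sub_const x)).const_mul (p x)
    refine h1.congr_fderiv ?_
    ext u
    simp
    ring

end Gaussian

/-- Score equals negative normalized expected noise: if `Y = X + σ • Z` with `X` integrable
with Lebesgue density `p`, `Z` an independent standard Gaussian, and `q` the density of `Y`,
then almost surely `∇(log q)(Y) = -(1/σ) • E[Z ∣ Y]`. -/
theorem score_eq_neg_normalized_expected_noise
    {D : ℕ} {Ω : Type*} [MeasurableSpace Ω] {μ : Measure Ω} [IsProbabilityMeasure μ]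
    (p : EuclideanSpace ℝ (Fin D) → ℝ)
    (hp_meas : Measurable p) (hp_nonneg : ∀ x, 0 ≤ p x)
    (hp_int : ∫ x, p x = 1)
    (σ : ℝ) (hσ : 0 < σ)
    (X Z : Ω → EuclideanSpace ℝ (Fin D))
    (hX : Measurable X) (hZ : Measurable Z)
    (hXint : Integrable X μ)
    (hXlaw : Measure.map X μ = volume.withDensity (fun x => ENNReal.ofReal (p x)))
    (hZlaw : Measure.map Z μ = volume.withDensity (fun z =>
      ENNReal.ofReal ((2 * π) ^ (-(D : ℝ) / 2) * Real.exp (-‖z‖ ^ 2 / 2))))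
    (hindep : IndepFun X Z μ)
    (Y : Ω → EuclideanSpace ℝ (Fin D))
    (hY : ∀ ω, Y ω = X ω + σ • Z ω)
    (q : EuclideanSpace ℝ (Fin D) → ℝ)
    (hq : ∀ y, q y = ∫ x, p x * ((2 * π * σ ^ 2) ^ (-(D : ℝ) / 2) *
      Real.exp (-‖y - x‖ ^ 2 / (2 * σ ^ 2)))) :
    (fun ω => gradient (fun v => Real.log (q v)) (Y ω)) =ᵐ[μ]
      fun ω => -(1 / σ) • (μ[Z | MeasurableSpace.comap Y inferInstance]) ω := by
  have hp : Integrable p := by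
    by_contra hn
    exact zero_ne_one ((integral_undef hn).symm.trans hp_int)
  have hY' : Y = fun ω => X ω + σ • Z ω := funext hY
  have hYm : Measurable Y := by
    rw [hY']
    exact hX.add (hZ.const_smul σ)
  have hq' : q = fun y => ∫ x, p x * isotropicGaussianPDF σ (y - x) := funext hq
  have hZlaw' : μ.map Z = volume.withDensity
      (fun z => ENNReal.ofReal (isotropicGaussianPDF 1 z)) := by
    rw [hZlaw]
    simp [isotropicGaussianPDF]
  have hZint : Integrable Z μ := by
    refine (integrable_map_measure (f := Z) (g := id) aestronglyMeasurable_id hZ.aemeasurable).1 ?_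
    rw [hZlaw', integrable_withDensity_iff_integrable_smul'
      (measurable_isotropicGaussianPDF 1).ennreal_ofReal (by simp)]
    simpa only [ENNReal.toReal_ofReal (isotropicGaussianPDF_pos one_pos _).le, id] using
      integrable_isotropicGaussianPDF_smul_self (D := D) one_pos
  have hWlaw : μ.map (fun ω => σ • Z ω) = volume.withDensity
      (fun w => ENNReal.ofReal (isotropicGaussianPDF σ w)) := by
    rw [← map_smul_withDensity_isotropicGaussianPDF hσ, ← hZlaw',
      Measure.map_map (measurable_const_smul σ) hZ]
    rfl
  have hk : Measurable (fun a : EuclideanSpace ℝ (Fin D) × EuclideanSpace ℝ (Fin D) =>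
      p a.1 * isotropicGaussianPDF σ (a.2 - a.1)) :=
    (hp_meas.comp measurable_fst).mul
      ((measurable_isotropicGaussianPDF σ).comp (measurable_snd.sub measurable_fst))
  have hlaw : μ.map (fun ω => (X ω, Y ω)) = (volume.prod volume).withDensity
      (fun a => ENNReal.ofReal (p a.1 * isotropicGaussianPDF σ (a.2 - a.1))) := by
    have hind : IndepFun X (fun ω => σ • Z ω) μ :=
      hindep.comp measurable_id (measurable_const_smul σ)
    have hprod := (indepFun_iff_map_prod_eq_prod_map_map (f := X) hX.aemeasurable
      (g := fun ω => σ • Z ω) (hZ.const_smul σ).aemeasurable).1 hind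
    rw [hXlaw, hWlaw, prod_withDensity hp_meas.ennreal_ofReal
      (measurable_isotropicGaussianPDF σ).ennreal_ofReal] at hprod
    have hXW : Measurable (fun ω => (X ω, σ • Z ω)) := hX.prodMk (hZ.const_smul σ)
    have hshear := measurePreserving_prod_add
      (volume : Measure (EuclideanSpace ℝ (Fin D))) (volume : Measure (EuclideanSpace ℝ (Fin D)))
    have hmap := Measure.map_withDensity_comp (ν := volume.prod volume) hshear.measurable
      hk.ennreal_ofReal
    rw [hshear.map_eq] at hmap
    rw [← hmap, hY', ← Function.comp_def (fun z => (z.1, z.1 + z.2)) (fun ω => (X ω, σ • Z ω)),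
      ← Measure.map_map hshear.measurable hXW, hprod]
    congr 2
    ext a
    simp only [add_sub_cancel_left]
    rw [ENNReal.ofReal_mul (hp_nonneg _)]
  have hZY : Z = fun ω => σ⁻¹ • (Y ω - X ω) := by
    ext1 ω
    rw [hY, add_sub_cancel_left, inv_smul_smul₀ hσ.ne']
  have hpos := integral_mul_isotropicGaussianPDF_sub_pos hp hp_nonneg (hp_int ▸ one_pos) hσ
  have hcond := condExp_ae_eq_of_joint_density hX hYm hk
    (fun a => mul_nonneg (hp_nonneg _) (isotropicGaussianPDF_pos hσ _).le) hpos hlaw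
    (f := fun a => σ⁻¹ • (a.2 - a.1))
    ((measurable_snd.sub measurable_fst).const_smul σ⁻¹).stronglyMeasurable (hZY ▸ hZint)
  rw [← hZY] at hcond
  filter_upwards [hcond] with ω hω
  rw [← hω]
  have hgrad : HasGradientAt (fun v => Real.log (q v)) ((q (Y ω))⁻¹ • -(1 / σ ^ 2) •
      ∫ x, (p x * isotropicGaussianPDF σ (Y ω - x)) • (Y ω - x)) (Y ω) := by
    rw [hasGradientAt_iff_hasFDerivAt, map_smul, hq']
    exact (hasGradientAt_integral_mul_isotropicGaussianPDF hp hσ (Y ω)).hasFDerivAt.log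
      (hpos (Y ω)).ne'
  rw [hgrad.gradient, hq']
  simp only [smul_comm _ σ⁻¹, integral_smul]
  simp only [smul_smul]
  congr 1
  field_simp
end

section
/- (One-dimensional Tweedie's formula.) Let X be an integrable real random variable whose law has a probability density p with respect to Lebesgue measure on ℝ, let Z be a standard Gaussian real random variable independent of X, let σ > 0, and set Y = X + σ·Z. Let q(y) = ∫ p(x) · (2πσ²)^{-1/2} · exp(−(y − x)²/(2σ²)) dx be the Lebesgue density of Y. Then q is strictly positive and differentiable on ℝ, and almost surely E[X ∣ Y] = Y + σ² · (q′(Y)/q(Y)). -/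
open MeasureTheory ProbabilityTheory Real

open scoped NNReal

/-- Conditional expectation from a joint density: if `(X, Y)` has joint density `D`, then
`E[X ∣ Y] = g(Y)` as soon as `g(y) * ∫ D(x, y) dx = ∫ D(x, y) * x dx` for all `y`. -/
theorem condExp_ae_eq_comp_of_map_prodMk_eq_withDensity
    {Ω : Type*} [MeasurableSpace Ω] {μ : Measure Ω} [IsFiniteMeasure μ] {X Y : Ω → ℝ}
    (hX : Measurable X) (hY : Measurable Y) (hXint : Integrable X μ) {D : ℝ × ℝ → ℝ}
    (hD : Measurable D) (hD0 : ∀ z, 0 ≤ D z)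
    (hlaw : μ.map (fun ω => (X ω, Y ω)) =
      (volume.prod volume).withDensity (fun z => ENNReal.ofReal (D z)))
    (hDint : ∀ y, Integrable (fun x => D (x, y))) {g : ℝ → ℝ} (hg : Measurable g)
    (hgD : ∀ y, (∫ x, D (x, y)) * g y = ∫ x, D (x, y) * x) :
    μ[X | MeasurableSpace.comap Y inferInstance] =ᵐ[μ] fun ω => g (Y ω) := by
  have hXY : Measurable (fun ω => (X ω, Y ω)) := hX.prodMk hY
  have hDm : Measurable (fun z => ENNReal.ofReal (D z)) := hD.ennreal_ofReal
  have hlt : ∀ᵐ z ∂(volume.prod volume : Measure (ℝ × ℝ)), ENNReal.ofReal (D z) < ⊤ :=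
    ae_of_all _ fun z => ENNReal.ofReal_lt_top
  have integrable_iff (f : ℝ × ℝ → ℝ) (hf : Measurable f) :
      Integrable (fun ω => f (X ω, Y ω)) μ ↔
        Integrable (fun z => D z * f z) (volume.prod volume) := by
    have h := integrable_map_measure (μ := μ) (f := fun ω => (X ω, Y ω)) (g := f)
      hf.aestronglyMeasurable hXY.aemeasurable
    rw [hlaw, integrable_withDensity_iff_integrable_smul' hDm hlt] at h
    simpa [ENNReal.toReal_ofReal (hD0 _), Function.comp_def] using h.symm
  have setIntegral_eq (f : ℝ × ℝ → ℝ) (hf : Measurable f)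
      (hfi : Integrable (fun z => D z * f z) (volume.prod volume)) (B : Set ℝ)
      (hB : MeasurableSet B) :
      ∫ ω in Y ⁻¹' B, f (X ω, Y ω) ∂μ = ∫ y in B, ∫ x, D (x, y) * f (x, y) := by
    have hs : MeasurableSet ((Set.univ : Set ℝ) ×ˢ B) := MeasurableSet.univ.prod hB
    have h := setIntegral_map (μ := μ) (g := fun ω => (X ω, Y ω)) (f := f) hs
      hf.aestronglyMeasurable hXY.aemeasurable
    have hpre : (fun ω => (X ω, Y ω)) ⁻¹' ((Set.univ : Set ℝ) ×ˢ B) = Y ⁻¹' B := by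
      ext; simp
    rw [hpre] at h
    rw [← h, hlaw, restrict_withDensity hs,
      integral_withDensity_eq_integral_toReal_smul hDm (ae_restrict_of_ae hlt),
      ← Measure.prod_restrict, Measure.restrict_univ]
    simp only [ENNReal.toReal_ofReal (hD0 _), smul_eq_mul]
    refine integral_prod_symm _ ?_
    have := hfi.integrableOn (s := (Set.univ : Set ℝ) ×ˢ B)
    rwa [IntegrableOn, ← Measure.prod_restrict, Measure.restrict_univ] at this
  have hDX : Integrable (fun z : ℝ × ℝ => D z * z.1) (volume.prod volume) :=
    (integrable_iff Prod.fst measurable_fst).1 hXint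
  have hDg : Integrable (fun z : ℝ × ℝ => D z * g z.2) (volume.prod volume) := by
    rw [integrable_prod_iff' (by fun_prop)]
    refine ⟨ae_of_all _ fun y => (hDint y).mul_const (g y), ?_⟩
    convert! hDX.integral_prod_right.norm using 2 with y
    simp only [norm_mul]
    rw [integral_mul_const, ← hgD y, norm_mul]
    have hq0 : 0 ≤ ∫ x, D (x, y) := integral_nonneg fun x => hD0 (x, y)
    simp only [Real.norm_eq_abs, abs_of_nonneg (hD0 _), abs_of_nonneg hq0]
  have hgY : Integrable (fun ω => g (Y ω)) μ :=
    (integrable_iff (fun z => g z.2) (by fun_prop)).2 hDg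
  refine (ae_eq_condExp_of_forall_setIntegral_eq hY.comap_le hXint
    (fun _ _ _ => hgY.integrableOn) ?_ ?_).symm
  · rintro _ ⟨B, hB, rfl⟩ -
    rw [setIntegral_eq (fun z => g z.2) (by fun_prop) hDg B hB,
      setIntegral_eq Prod.fst measurable_fst hDX B hB]
    simp only [integral_mul_const, hgD]
  · exact (hg.comp (comap_measurable Y)).aestronglyMeasurable

/-- Adding independent noise with density `f` to `X` gives a pair with joint density
`p(x) * f(y - x)`. -/
theorem ProbabilityTheory.IndepFun.map_prodMk_add_eq_withDensity
    {Ω : Type*} [MeasurableSpace Ω] {μ : Measure Ω} [IsFiniteMeasure μ] {X W : Ω → ℝ}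
    (hX : Measurable X) (hW : Measurable W) (hindep : IndepFun X W μ) {p f : ℝ → ENNReal}
    (hp : Measurable p) (hf : Measurable f) (hXlaw : μ.map X = volume.withDensity p)
    (hWlaw : μ.map W = volume.withDensity f) :
    μ.map (fun ω => (X ω, X ω + W ω)) =
      (volume.prod volume).withDensity (fun z => p z.1 * f (z.2 - z.1)) := by
  have : SFinite (volume.withDensity p) := hXlaw ▸ inferInstance
  have hshear := measurePreserving_prod_add (volume : Measure ℝ) (volume : Measure ℝ)
  have h := (indepFun_iff_map_prod_eq_prod_map_map hX.aemeasurable hW.aemeasurable).1 hindep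
  rw [hXlaw, hWlaw, prod_withDensity hp hf] at h
  have hcomp : (fun ω => (X ω, X ω + W ω)) =
      (fun z : ℝ × ℝ => (z.1, z.1 + z.2)) ∘ fun ω => (X ω, W ω) := rfl
  rw [hcomp, ← Measure.map_map hshear.measurable (hX.prodMk hW), h]
  ext s hs
  rw [Measure.map_apply hshear.measurable hs, withDensity_apply _ (hshear.measurable hs),
    withDensity_apply _ hs, ← hshear.setLIntegral_comp_preimage hs (by fun_prop)]
  simp

theorem hasDerivAt_gaussianPDFReal (m : ℝ) (v : ℝ≥0) (y : ℝ) :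
    HasDerivAt (gaussianPDFReal m v) ((m - y) / v * gaussianPDFReal m v y) y := by
  rw [gaussianPDFReal_def]
  have h : HasDerivAt (fun y : ℝ => -(y - m) ^ 2 / (2 * v)) ((m - y) / v) y := by
    have h1 := ((((hasDerivAt_id y).sub_const m).pow 2).neg).div_const (2 * (v : ℝ))
    convert! h1 using 1
    simp only [id]
    rw [show -((2 : ℕ) * (y - m) ^ (2 - 1) * 1 : ℝ) = 2 * (m - y) by push_cast; ring,
      mul_div_mul_left _ _ two_ne_zero]
  convert! (h.exp.const_mul (√(2 * π * v))⁻¹) using 1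
  ring

theorem gaussianPDFReal_le (m : ℝ) (v : ℝ≥0) (y : ℝ) :
    gaussianPDFReal m v y ≤ (√(2 * π * v))⁻¹ := by
  rw [gaussianPDFReal]
  refine mul_le_of_le_one_right (by positivity) (Real.exp_le_one_iff.2 ?_)
  rw [neg_div]
  exact neg_nonpos.2 (by positivity)

theorem abs_sub_mul_gaussianPDFReal_le (m : ℝ) {v : ℝ≥0} (hv : v ≠ 0) (y : ℝ) :
    |m - y| * gaussianPDFReal m v y ≤ (1 + v) * (√(2 * π * v))⁻¹ := by
  have hv' : (0 : ℝ) < v := by positivity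
  rw [gaussianPDFReal, mul_left_comm, mul_comm _ (√(2 * π * v))⁻¹]
  refine mul_le_mul_of_nonneg_left ?_ (by positivity)
  rw [neg_div, Real.exp_neg, ← div_eq_mul_inv, div_le_iff₀ (Real.exp_pos _)]
  set a := (y - m) ^ 2 / (2 * v) with ha
  have ha' : (y - m) ^ 2 = a * (2 * v) := by rw [ha]; field_simp
  have ha0 : 0 ≤ a := by positivity
  have h1 : a + 1 ≤ Real.exp a := Real.add_one_le_exp a
  have h2 : (1 + v) * (a + 1) ≤ (1 + v) * Real.exp a :=
    mul_le_mul_of_nonneg_left h1 (by positivity)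
  have h3 : 2 * |m - y| ≤ 1 + (y - m) ^ 2 := by
    rw [← sq_abs, abs_sub_comm y m]
    nlinarith [sq_nonneg (|m - y| - 1)]
  nlinarith

theorem integrable_mul_gaussianPDFReal {p : ℝ → ℝ} (hp : Integrable p) (v : ℝ≥0) (y : ℝ) :
    Integrable (fun x => p x * gaussianPDFReal x v y) := by
  refine hp.mul_bdd (c := (√(2 * π * v))⁻¹) ?_ (ae_of_all _ fun x => ?_)
  · exact Measurable.aestronglyMeasurable (by fun_prop)
  · rw [Real.norm_eq_abs, abs_of_nonneg (gaussianPDFReal_nonneg _ _ _)]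
    exact gaussianPDFReal_le _ _ _

/-- A Gaussian convolution may be differentiated under the integral sign. -/
theorem hasDerivAt_integral_mul_gaussianPDFReal {p : ℝ → ℝ} (hp : Integrable p) {v : ℝ≥0}
    (hv : v ≠ 0) (y : ℝ) :
    Integrable (fun x => p x * ((x - y) / v * gaussianPDFReal x v y)) ∧
      HasDerivAt (fun y => ∫ x, p x * gaussianPDFReal x v y)
        (∫ x, p x * ((x - y) / v * gaussianPDFReal x v y)) y := by
  have hv' : (0 : ℝ) < v := by positivity
  refine hasDerivAt_integral_of_dominated_loc_of_deriv_le (s := Set.univ)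
    (F := fun y x => p x * gaussianPDFReal x v y)
    (F' := fun y x => p x * ((x - y) / v * gaussianPDFReal x v y))
    (bound := fun x => |p x| * ((1 + v) * (√(2 * π * v))⁻¹ / v)) Filter.univ_mem
    (Filter.Eventually.of_forall fun y => (integrable_mul_gaussianPDFReal hp v y).1)
    (integrable_mul_gaussianPDFReal hp v y) ?_ (ae_of_all _ fun x z _ => ?_)
    (hp.abs.mul_const _) (ae_of_all _ fun x z _ => (hasDerivAt_gaussianPDFReal x v z).const_mul _)
  · exact hp.1.mul (Measurable.aestronglyMeasurable (by fun_prop))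
  · rw [norm_mul, Real.norm_eq_abs]
    refine mul_le_mul_of_nonneg_left ?_ (abs_nonneg _)
    rw [Real.norm_eq_abs, abs_mul, abs_div, abs_of_pos hv',
      abs_of_nonneg (gaussianPDFReal_nonneg _ _ _), div_mul_eq_mul_div]
    exact div_le_div_of_nonneg_right (abs_sub_mul_gaussianPDFReal_le x hv z) hv'.le

theorem integral_mul_gaussianPDFReal_pos {p : ℝ → ℝ} (hp0 : ∀ x, 0 ≤ p x)
    (hp : 0 < ∫ x, p x) {v : ℝ≥0} (hv : v ≠ 0) (y : ℝ) :
    0 < ∫ x, p x * gaussianPDFReal x v y := by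
  have hpi : Integrable p := .of_integral_ne_zero hp.ne'
  rw [integral_pos_iff_support_of_nonneg
    (fun x => mul_nonneg (hp0 x) (gaussianPDFReal_nonneg _ _ _))
    (integrable_mul_gaussianPDFReal hpi v y)]
  rw [integral_pos_iff_support_of_nonneg hp0 hpi] at hp
  convert! hp using 2
  ext x
  simp [(gaussianPDFReal_pos x v y hv).ne']

/-- The numerator of the posterior mean, in terms of the derivative of the smoothed density. -/
theorem integral_mul_gaussianPDFReal_mul_id {p : ℝ → ℝ} (hp : Integrable p) {v : ℝ≥0}
    (hv : v ≠ 0) (y : ℝ) :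
    ∫ x, p x * gaussianPDFReal x v y * x =
      y * (∫ x, p x * gaussianPDFReal x v y) +
        v * deriv (fun y => ∫ x, p x * gaussianPDFReal x v y) y := by
  have hv' : (v : ℝ) ≠ 0 := by positivity
  obtain ⟨hi, hd⟩ := hasDerivAt_integral_mul_gaussianPDFReal hp hv y
  rw [hd.deriv, ← integral_const_mul, ← integral_const_mul,
    ← integral_add ((integrable_mul_gaussianPDFReal hp v y).const_mul y) (hi.const_mul _)]
  congr 1 with x
  field_simp
  ring

theorem two_mul_pi_mul_rpow_neg_half (v : ℝ≥0) :
    (2 * π * (v : ℝ)) ^ (-(1 : ℝ) / 2) = (√(2 * π * v))⁻¹ := by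
  rw [neg_div, Real.rpow_neg (by positivity), Real.sqrt_eq_rpow]

/-- One-dimensional Tweedie's formula: if `Y = X + σ * Z` with `X` an integrable real random
variable with Lebesgue density `p`, `Z` an independent standard Gaussian, and
`q(y) = ∫ p(x) * (2πσ²)^(-1/2) * exp (-(y - x)²/(2σ²)) dx` the density of `Y`, then `q` is
strictly positive and differentiable on `ℝ` and almost surely
`E[X ∣ Y] = Y + σ² * (q′(Y)/q(Y))`. -/
theorem tweedie_formula_one_dim
    {Ω : Type*} [MeasurableSpace Ω] {μ : Measure Ω} [IsProbabilityMeasure μ]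
    (p : ℝ → ℝ)
    (hp_meas : Measurable p) (hp_nonneg : ∀ x, 0 ≤ p x)
    (hp_int : ∫ x, p x = 1)
    (σ : ℝ) (hσ : 0 < σ)
    (X Z : Ω → ℝ)
    (hX : Measurable X) (hZ : Measurable Z)
    (hXint : Integrable X μ)
    (hXlaw : Measure.map X μ = volume.withDensity (fun x => ENNReal.ofReal (p x)))
    (hZlaw : Measure.map Z μ = volume.withDensity (fun z =>
      ENNReal.ofReal ((2 * π) ^ (-(1 : ℝ) / 2) * Real.exp (-z ^ 2 / 2))))
    (hindep : IndepFun X Z μ)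
    (Y : Ω → ℝ)
    (hY : ∀ ω, Y ω = X ω + σ * Z ω)
    (q : ℝ → ℝ)
    (hq : ∀ y, q y = ∫ x, p x * ((2 * π * σ ^ 2) ^ (-(1 : ℝ) / 2) *
      Real.exp (-(y - x) ^ 2 / (2 * σ ^ 2)))) :
    (∀ y, 0 < q y ∧ DifferentiableAt ℝ q y) ∧
      μ[X | MeasurableSpace.comap Y inferInstance] =ᵐ[μ]
        fun ω => Y ω + σ ^ 2 * (deriv q (Y ω) / q (Y ω)) := by
  set v : ℝ≥0 := .mk (σ ^ 2) (sq_nonneg σ)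
  have hvσ : (v : ℝ) = σ ^ 2 := rfl
  have hv : v ≠ 0 := by
    rw [← NNReal.coe_ne_zero, hvσ]
    positivity
  have hp : Integrable p := .of_integral_ne_zero (by simp [hp_int])
  obtain rfl : Y = fun ω => X ω + σ * Z ω := funext hY
  obtain rfl : q = fun y => ∫ x, p x * gaussianPDFReal x v y := by
    ext y
    rw [hq, ← hvσ, two_mul_pi_mul_rpow_neg_half]
    rfl
  have hpos := integral_mul_gaussianPDFReal_pos hp_nonneg (hp_int ▸ one_pos) hv
  have hdiff : Differentiable ℝ fun y => ∫ x, p x * gaussianPDFReal x v y := fun y =>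
    (hasDerivAt_integral_mul_gaussianPDFReal hp hv y).2.differentiableAt
  refine ⟨fun y => ⟨hpos y, hdiff y⟩, ?_⟩
  have hZ' : HasLaw Z (gaussianReal 0 1) μ := by
    refine ⟨hZ.aemeasurable, ?_⟩
    rw [hZlaw, gaussianReal_of_var_ne_zero _ one_ne_zero]
    congr 1 with z
    have := two_mul_pi_mul_rpow_neg_half 1
    simp only [NNReal.coe_one, mul_one] at this
    simp [gaussianPDF, gaussianPDFReal, this]
  have hσZ : μ.map (fun ω => σ * Z ω) = volume.withDensity (gaussianPDF 0 v) := by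
    rw [(gaussianReal_const_mul hZ' σ).map_eq, mul_zero, mul_one,
      gaussianReal_of_var_ne_zero _ hv]
  have hjoint := IndepFun.map_prodMk_add_eq_withDensity hX (hZ.const_mul σ)
    (hindep.comp measurable_id (measurable_const_mul σ)) hp_meas.ennreal_ofReal
    (measurable_gaussianPDF 0 v) hXlaw hσZ
  refine condExp_ae_eq_comp_of_map_prodMk_eq_withDensity
    (D := fun z => p z.1 * gaussianPDFReal z.1 v z.2)
    (g := fun y => y + σ ^ 2 * (deriv (fun y => ∫ x, p x * gaussianPDFReal x v y) y /
      ∫ x, p x * gaussianPDFReal x v y))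
    hX (by fun_prop) hXint (by fun_prop)
    (fun z => mul_nonneg (hp_nonneg _) (gaussianPDFReal_nonneg _ _ _)) ?_
    (integrable_mul_gaussianPDFReal hp v) ?_ fun y => ?_
  · rw [hjoint]
    congr 1 with z
    rw [gaussianPDF, gaussianPDFReal_sub, zero_add, ENNReal.ofReal_mul (hp_nonneg _)]
  · exact measurable_id.add
      (((measurable_deriv _).div hdiff.continuous.measurable).const_mul _)
  · have := (hpos y).ne'
    rw [integral_mul_gaussianPDFReal_mul_id hp hv y, hvσ]
    field_simp
end
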